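/- Let (Z,ρ₀) be an antipodal space, ρ₁ ∈ M(Z), τ₀ ∈ C(Z), and let t ↦ τ_t, t ∈ [0,∞), be a solution of the ρ₁-antipodal flow with initial value τ₀. Then the limit τ_∞ := lim_{t→∞} τ_t exists in C(Z), with the estimate ‖τ_t − τ_∞‖_∞ ≤ 4‖D_{ρ₁}(τ₀)‖_∞ · e^{−t/2} for all t ≥ 0; moreover D_{ρ₁}(τ_∞) ≡ 0, so that the function ρ := E_{ρ₁}(τ_∞) is an antipodal function Moebius equivalent to ρ₁, i.e. ρ ∈ M(Z), and log(dρ/dρ₁) = τ_∞. -/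

import Mathlib

open Filter Topology
open scoped Classical

variable {Z : Type*}

/-- `Z` has at least four points. -/
def HasFourPoints (Z : Type*) : Prop :=
  ∃ a b c d : Z, a ≠ b ∧ a ≠ c ∧ a ≠ d ∧ b ≠ c ∧ b ≠ d ∧ c ≠ d

/-- A separating function on `Z`: continuous, symmetric, and positive. -/
structure IsSeparating [TopologicalSpace Z] (ρ : Z → Z → ℝ) : Prop where
  continuous : Continuous fun p : Z × Z => ρ p.1 p.2
  symm : ∀ ξ η, ρ ξ η = ρ η ξ
  nonneg : ∀ ξ η, 0 ≤ ρ ξ η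
  eq_zero_iff : ∀ ξ η, ρ ξ η = 0 ↔ ξ = η

/-- The cross-ratio of a quadruple of points with respect to `ρ`. -/
noncomputable def crossRatio (ρ : Z → Z → ℝ) (ξ ξ' η η' : Z) : ℝ :=
  ρ ξ η * ρ ξ' η' / (ρ ξ η' * ρ ξ' η)

/-- Two functions are Moebius equivalent if their cross-ratios agree on all quadruples
of pairwise distinct points. -/
def MoebiusEquiv (ρ₁ ρ₂ : Z → Z → ℝ) : Prop :=
  ∀ ξ ξ' η η' : Z, ξ ≠ ξ' → ξ ≠ η → ξ ≠ η' → ξ' ≠ η → ξ' ≠ η' → η ≠ η' →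
    crossRatio ρ₁ ξ ξ' η η' = crossRatio ρ₂ ξ ξ' η η'

/-- An antipodal function on `Z`: a separating function with values in `[0,1]` such that
every point has an antipode. -/
structure IsAntipodal [TopologicalSpace Z] (ρ : Z → Z → ℝ) : Prop where
  toIsSeparating : IsSeparating ρ
  le_one : ∀ ξ η, ρ ξ η ≤ 1
  antipode : ∀ ξ, ∃ η, ρ ξ η = 1

/-- The Moebius space `M(Z, ρ₀)`: antipodal functions Moebius equivalent to `ρ₀`. -/
def MoebiusSpace [TopologicalSpace Z] (ρ₀ : Z → Z → ℝ) : Set (Z → Z → ℝ) :=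
  {ρ | IsAntipodal ρ ∧ MoebiusEquiv ρ₀ ρ}

/-- The derivative `dρ₂/dρ₁`: the (unique, when it exists) positive continuous function
satisfying the geometric mean value theorem
`ρ₂(ξ,η)² = f(ξ) f(η) ρ₁(ξ,η)²`. -/
noncomputable def mDeriv [TopologicalSpace Z] (ρ₁ ρ₂ : Z → Z → ℝ) : Z → ℝ :=
  if h : ∃ f : Z → ℝ, Continuous f ∧ (∀ ξ, 0 < f ξ) ∧
      ∀ ξ η, ρ₂ ξ η ^ 2 = f ξ * f η * ρ₁ ξ η ^ 2
  then h.choose else fun _ => 1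

/-- The metric `d_M(ρ₁, ρ₂) = ‖log (dρ₂/dρ₁)‖_∞` on the Moebius space. -/
noncomputable def dM [TopologicalSpace Z] (ρ₁ ρ₂ : Z → Z → ℝ) : ℝ :=
  ⨆ ξ : Z, |Real.log (mDeriv ρ₁ ρ₂ ξ)|

/-- The discrepancy function `D_{ρ₁}(τ)(ξ) = max_{η ≠ ξ} (τ(ξ) + τ(η) + log ρ₁(ξ,η)²)`. -/
noncomputable def discrepancy [TopologicalSpace Z] (ρ₁ : Z → Z → ℝ) (τ : C(Z, ℝ))
    (ξ : Z) : ℝ :=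
  ⨆ η : {η : Z // η ≠ ξ}, (τ ξ + τ η.1 + Real.log (ρ₁ ξ η.1 ^ 2))

/-- `E_{ρ₁}(τ)(ξ,η) = e^{τ(ξ)/2} e^{τ(η)/2} ρ₁(ξ,η)`. -/
noncomputable def eMap [TopologicalSpace Z] (ρ₁ : Z → Z → ℝ) (τ : C(Z, ℝ)) :
    Z → Z → ℝ :=
  fun ξ η => Real.exp (τ ξ / 2) * Real.exp (τ η / 2) * ρ₁ ξ η

/-- A solution of the `ρ₁`-antipodal flow `dτ_t/dt = -D_{ρ₁}(τ_t)` on `[0, ∞)`. -/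
def IsAntipodalFlowSol [TopologicalSpace Z] [CompactSpace Z]
    (ρ₁ : Z → Z → ℝ) (τ : ℝ → C(Z, ℝ)) : Prop :=
  ∀ t ∈ Set.Ici (0 : ℝ), ∃ τ' : C(Z, ℝ),
    (∀ ξ, τ' ξ = -discrepancy ρ₁ (τ t) ξ) ∧
    HasDerivWithinAt τ τ' (Set.Ici (0 : ℝ)) t

/-- The antipodalization map `P_∞(τ₀, ρ₁) = E_{ρ₁}(τ_∞)`, where `τ_∞` is the limit as
`t → ∞` of the solution of the `ρ₁`-antipodal flow starting at `τ₀`. -/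
noncomputable def antipodalization [TopologicalSpace Z] [CompactSpace Z]
    (ρ₁ : Z → Z → ℝ) (τ₀ : C(Z, ℝ)) : Z → Z → ℝ :=
  if h : ∃ p : (ℝ → C(Z, ℝ)) × C(Z, ℝ), p.1 0 = τ₀ ∧ IsAntipodalFlowSol ρ₁ p.1 ∧
      Filter.Tendsto p.1 Filter.atTop (𝓝 p.2)
  then eMap ρ₁ h.choose.2 else ρ₁

lemma le_of_hasDerivWithinAt_nonneg {f f' : ℝ → ℝ} {s t : ℝ} (hs : 0 ≤ s) (hst : s ≤ t)
    (hf : ∀ x ∈ Set.Ici (0 : ℝ), HasDerivWithinAt f (f' x) (Set.Ici 0) x)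
    (hf' : ∀ x ∈ Set.Icc s t, 0 ≤ f' x) : f s ≤ f t := by
  have hsub : Set.Icc s t ⊆ Set.Ici (0 : ℝ) := fun x hx => hs.trans hx.1
  have hmono : MonotoneOn f (Set.Icc s t) :=
    monotoneOn_of_hasDerivWithinAt_nonneg (f' := f') (convex_Icc s t)
      (fun x hx => ((hf x (hsub hx)).mono hsub).continuousWithinAt)
      (fun x hx => (hf x (hsub (interior_subset hx))).mono (interior_subset.trans hsub))
      (fun x hx => hf' x (interior_subset hx))
  exact hmono (Set.left_mem_Icc.2 hst) (Set.right_mem_Icc.2 hst) hst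

lemma HasFourPoints.exists_ne_ne (h4 : HasFourPoints Z) (ξ : Z) :
    ∃ η ζ : Z, η ≠ ξ ∧ ζ ≠ ξ ∧ η ≠ ζ := by
  obtain ⟨a, b, c, d, hab, hac, -, hbc, -, -⟩ := h4
  by_cases ha : a = ξ
  · subst ha
    exact ⟨b, c, hab.symm, hac.symm, hbc⟩
  · by_cases hb : b = ξ
    · subst hb
      exact ⟨a, c, ha, hbc.symm, hac⟩
    · exact ⟨a, b, ha, hb, hab⟩

section Discrepancy

variable [TopologicalSpace Z] {ρ : Z → Z → ℝ}

lemma IsAntipodal.log_sq_nonpos (h : IsAntipodal ρ) (ξ η : Z) : Real.log (ρ ξ η ^ 2) ≤ 0 :=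
  Real.log_nonpos (sq_nonneg _) (pow_le_one₀ (h.toIsSeparating.nonneg _ _) (h.le_one _ _))

lemma IsSeparating.pos (h : IsSeparating ρ) {ξ η : Z} (hne : η ≠ ξ) : 0 < ρ ξ η :=
  lt_of_le_of_ne (h.nonneg _ _) fun h' => hne ((h.eq_zero_iff _ _).1 h'.symm).symm

lemma discrepancy_le (h4 : HasFourPoints Z) {σ : C(Z, ℝ)} {ξ : Z} {b : ℝ}
    (h : ∀ η, η ≠ ξ → σ ξ + σ η + Real.log (ρ ξ η ^ 2) ≤ b) : discrepancy ρ σ ξ ≤ b := by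
  obtain ⟨η, -, hη, -⟩ := h4.exists_ne_ne ξ
  have : Nonempty {η : Z // η ≠ ξ} := ⟨⟨η, hη⟩⟩
  exact ciSup_le fun η => h η.1 η.2

lemma log_eMap_sq (h : IsSeparating ρ) (σ : C(Z, ℝ)) {ξ η : Z} (hne : η ≠ ξ) :
    Real.log (eMap ρ σ ξ η ^ 2) = σ ξ + σ η + Real.log (ρ ξ η ^ 2) := by
  have hρ := (h.pos hne).ne'
  unfold eMap
  rw [← Real.exp_add, Real.log_pow, Real.log_mul (Real.exp_ne_zero _) hρ, Real.log_exp,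
    Real.log_pow]
  push_cast
  ring

lemma IsSeparating.eMap (h : IsSeparating ρ) (σ : C(Z, ℝ)) : IsSeparating (eMap ρ σ) where
  continuous := by
    have := h.continuous
    unfold _root_.eMap
    fun_prop
  symm ξ η := by
    simp only [_root_.eMap, h.symm ξ η]
    ring
  nonneg ξ η := mul_nonneg (by positivity) (h.nonneg ξ η)
  eq_zero_iff ξ η := by
    simp [_root_.eMap, h.eq_zero_iff]

lemma moebiusEquiv_eMap (ρ : Z → Z → ℝ) (σ : C(Z, ℝ)) : MoebiusEquiv ρ (eMap ρ σ) := by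
  intro ξ ξ' η η' _ _ _ _ _ _
  simp only [crossRatio, eMap]
  have hc : Real.exp (σ ξ / 2) * Real.exp (σ ξ' / 2) * Real.exp (σ η / 2)
      * Real.exp (σ η' / 2) ≠ 0 := by positivity
  rw [← mul_div_mul_left (ρ ξ η * ρ ξ' η') (ρ ξ η' * ρ ξ' η) hc]
  congr 1 <;> ring

lemma log_mDeriv_eMap (h : IsSeparating ρ) (h4 : HasFourPoints Z) (σ : C(Z, ℝ)) (ξ : Z) :
    Real.log (mDeriv ρ (eMap ρ σ) ξ) = σ ξ := by
  have hsq : ∀ ξ η, eMap ρ σ ξ η ^ 2 = Real.exp (σ ξ) * Real.exp (σ η) * ρ ξ η ^ 2 := by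
    intro ξ η
    have hexp : ∀ x : ℝ, Real.exp x = Real.exp (x / 2) ^ 2 := fun x => by
      rw [← Real.exp_nat_mul]
      congr 1
      push_cast
      ring
    rw [hexp (σ ξ), hexp (σ η), eMap]
    ring
  have hex : ∃ f : Z → ℝ, Continuous f ∧ (∀ ξ, 0 < f ξ) ∧
      ∀ ξ η, eMap ρ σ ξ η ^ 2 = f ξ * f η * ρ ξ η ^ 2 :=
    ⟨fun ξ => Real.exp (σ ξ), by fun_prop, fun ξ => Real.exp_pos _, hsq⟩
  rw [mDeriv, dif_pos hex]
  obtain ⟨-, hpos, hf⟩ := hex.choose_spec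
  generalize hex.choose = f at hpos hf ⊢
  have key : ∀ x y, y ≠ x → Real.log (f x) + Real.log (f y) = σ x + σ y := by
    intro x y hne
    have heq := mul_right_cancel₀ (pow_ne_zero 2 (h.pos hne).ne') ((hf x y).symm.trans (hsq x y))
    rw [← Real.log_mul (hpos x).ne' (hpos y).ne', heq, ← Real.exp_add, Real.log_exp]
  obtain ⟨η, ζ, hη, hζ, hne⟩ := h4.exists_ne_ne ξ
  have h₁ := key ξ η hη
  have h₂ := key ξ ζ hζ
  have h₃ := key ζ η hne
  linarith

variable [CompactSpace Z]

lemma IsAntipodal.le_discrepancy (h : IsAntipodal ρ) (σ : C(Z, ℝ)) {ξ η : Z} (hne : η ≠ ξ) :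
    σ ξ + σ η + Real.log (ρ ξ η ^ 2) ≤ discrepancy ρ σ ξ := by
  refine le_ciSup (f := fun η : {η : Z // η ≠ ξ} => σ ξ + σ η.1 + Real.log (ρ ξ η.1 ^ 2))
    ⟨‖σ‖ + ‖σ‖, ?_⟩ ⟨η, hne⟩
  rintro _ ⟨ζ, rfl⟩
  have h₁ := (le_abs_self _).trans (σ.norm_coe_le_norm ξ)
  have h₂ := (le_abs_self _).trans (σ.norm_coe_le_norm ζ.1)
  have h₃ := h.log_sq_nonpos ξ ζ.1
  dsimp only
  linarith

lemma IsAntipodal.discrepancy_le_add (h : IsAntipodal ρ) (h4 : HasFourPoints Z)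
    (σ σ' : C(Z, ℝ)) (ξ : Z) :
    discrepancy ρ σ ξ ≤ discrepancy ρ σ' ξ + 2 * ‖σ - σ'‖ := by
  refine discrepancy_le h4 fun η hne => ?_
  have h₁ := (le_abs_self _).trans ((σ - σ').norm_coe_le_norm ξ)
  have h₂ := (le_abs_self _).trans ((σ - σ').norm_coe_le_norm η)
  have h₃ := h.le_discrepancy σ' hne
  simp only [ContinuousMap.sub_apply] at h₁ h₂
  linarith

lemma IsAntipodal.eMap (h : IsAntipodal ρ) (h4 : HasFourPoints Z) {σ : C(Z, ℝ)}
    (hσ : ∀ ξ, discrepancy ρ σ ξ = 0) : IsAntipodal (eMap ρ σ) := by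
  have hs := h.toIsSeparating.eMap σ
  have hle : ∀ ξ η, _root_.eMap ρ σ ξ η ≤ 1 := by
    intro ξ η
    by_cases hne : η = ξ
    · rw [(hs.eq_zero_iff ξ η).2 hne.symm]
      exact zero_le_one
    · have h₁ := h.le_discrepancy σ hne
      rw [hσ, ← log_eMap_sq h.toIsSeparating σ hne, Real.log_pow] at h₁
      push_cast at h₁
      exact (Real.log_nonpos_iff (hs.nonneg _ _)).1 (by linarith)
  refine ⟨hs, hle, fun ξ => ?_⟩
  have hc : Continuous fun η => _root_.eMap ρ σ ξ η :=
    hs.continuous.comp (Continuous.prodMk_right ξ)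
  obtain ⟨η, -, hη⟩ := isCompact_univ.exists_isMaxOn ⟨ξ, Set.mem_univ ξ⟩ hc.continuousOn
  refine ⟨η, le_antisymm (hle ξ η) ?_⟩
  have hη' : ∀ ζ, _root_.eMap ρ σ ξ ζ ≤ _root_.eMap ρ σ ξ η := fun ζ => hη (Set.mem_univ ζ)
  have hsup : discrepancy ρ σ ξ ≤ Real.log (_root_.eMap ρ σ ξ η ^ 2) := by
    refine discrepancy_le h4 fun ζ hζ => ?_
    rw [← log_eMap_sq h.toIsSeparating σ hζ]
    exact Real.log_le_log (pow_pos (hs.pos hζ) 2)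
      (pow_le_pow_left₀ (hs.nonneg _ _) (hη' ζ) 2)
  obtain ⟨ζ, -, hζ, -⟩ := h4.exists_ne_ne ξ
  have hpos : 0 < _root_.eMap ρ σ ξ η := (hs.pos hζ).trans_le (hη' ζ)
  rw [hσ, Real.log_pow] at hsup
  push_cast at hsup
  exact (Real.log_nonneg_iff hpos).1 (by linarith)

end Discrepancy

section Flow

variable [TopologicalSpace Z] [CompactSpace Z] {ρ : Z → Z → ℝ} {τ : ℝ → C(Z, ℝ)}

lemma IsAntipodalFlowSol.hasDerivWithinAt (hτ : IsAntipodalFlowSol ρ τ) (ξ : Z) :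
    ∀ t ∈ Set.Ici (0 : ℝ),
      HasDerivWithinAt (fun t => τ t ξ) (-discrepancy ρ (τ t) ξ) (Set.Ici 0) t := by
  intro t ht
  obtain ⟨τ', hτ', hd⟩ := hτ t ht
  rw [← hτ' ξ]
  exact (ContinuousMap.evalCLM ℝ ξ).hasFDerivAt.comp_hasDerivWithinAt t hd

lemma IsAntipodalFlowSol.abs_discrepancy_le_iSup (hτ : IsAntipodalFlowSol ρ τ) (ξ : Z) :
    |discrepancy ρ (τ 0) ξ| ≤ ⨆ η : Z, |discrepancy ρ (τ 0) η| := by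
  obtain ⟨τ', hτ', -⟩ := hτ 0 Set.self_mem_Ici
  refine le_ciSup (f := fun η => |discrepancy ρ (τ 0) η|) ⟨‖τ'‖, ?_⟩ ξ
  rintro _ ⟨η, rfl⟩
  have h₁ := τ'.norm_coe_le_norm η
  rwa [hτ', norm_neg] at h₁

/-- Positive discrepancy decays along the flow at rate `2`. -/
lemma IsAntipodalFlowSol.discrepancy_le (hτ : IsAntipodalFlowSol ρ τ) (h : IsAntipodal ρ)
    (h4 : HasFourPoints Z) {t : ℝ} (ht : 0 ≤ t) (ξ : Z) :
    discrepancy ρ (τ t) ξ ≤ discrepancy ρ (τ 0) ξ * Real.exp (-2 * t) := by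
  refine _root_.discrepancy_le h4 fun η hne => ?_
  have hexp : ∀ s ∈ Set.Ici (0 : ℝ), HasDerivWithinAt (fun s => Real.exp (2 * s))
      (Real.exp (2 * s) * 2) (Set.Ici 0) s := fun s _ => by
    simpa using (((hasDerivAt_id s).const_mul 2).exp).hasDerivWithinAt
  have hmono := le_of_hasDerivWithinAt_nonneg le_rfl ht
    (fun s hs => (((hexp s hs).mul (((hτ.hasDerivWithinAt ξ s hs).add
      (hτ.hasDerivWithinAt η s hs)).add_const (Real.log (ρ ξ η ^ 2)))).neg))
    (fun s _ => by
      have h₁ := h.le_discrepancy (τ s) hne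
      have h₂ := h.le_discrepancy (τ s) hne.symm
      rw [h.toIsSeparating.symm η ξ] at h₂
      have := mul_nonneg (Real.exp_pos (2 * s)).le (show
        0 ≤ discrepancy ρ (τ s) ξ + discrepancy ρ (τ s) η
          - 2 * (τ s ξ + τ s η + Real.log (ρ ξ η ^ 2)) by linarith)
      simp only [Pi.add_apply]
      linarith)
  simp only [Pi.neg_apply, Pi.mul_apply, Pi.add_apply, mul_zero, Real.exp_zero, one_mul,
    neg_le_neg_iff] at hmono
  have hle := hmono.trans (h.le_discrepancy (τ 0) hne)
  have hcancel : Real.exp (2 * t) * Real.exp (-2 * t) = 1 := by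
    rw [← Real.exp_add]
    simp
  have := mul_le_mul_of_nonneg_right hle (Real.exp_pos (-2 * t)).le
  linear_combination this - (τ t ξ + τ t η + Real.log (ρ ξ η ^ 2)) * hcancel

/-- The part `M(τ)(ξ) = D(τ)(ξ) - τ(ξ)` of the discrepancy is almost nondecreasing in time. -/
lemma IsAntipodalFlowSol.discrepancy_sub_le (hτ : IsAntipodalFlowSol ρ τ) (h : IsAntipodal ρ)
    (h4 : HasFourPoints Z) {C : ℝ} (hC : ∀ ξ, discrepancy ρ (τ 0) ξ ≤ C) (hC₀ : 0 ≤ C)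
    {s t : ℝ} (hs : 0 ≤ s) (hst : s ≤ t) (ξ : Z) :
    discrepancy ρ (τ s) ξ - τ s ξ
      ≤ discrepancy ρ (τ t) ξ - τ t ξ + C / 2 * Real.exp (-2 * s) := by
  rw [sub_le_iff_le_add]
  refine _root_.discrepancy_le h4 fun η hne => ?_
  have hexp : ∀ x ∈ Set.Ici (0 : ℝ), HasDerivWithinAt (fun x => Real.exp (-2 * x))
      (Real.exp (-2 * x) * (-2)) (Set.Ici 0) x := fun x _ => by
    simpa using (((hasDerivAt_id x).const_mul (-2)).exp).hasDerivWithinAt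
  have hmono := le_of_hasDerivWithinAt_nonneg hs hst
    (fun x hx => (hτ.hasDerivWithinAt η x hx).sub ((hexp x hx).const_mul (C / 2)))
    (fun x hx => by
      have h₁ := hτ.discrepancy_le h h4 (hs.trans hx.1) η
      have h₂ := mul_le_mul_of_nonneg_right (hC η) (Real.exp_pos (-2 * x)).le
      linarith)
  simp only [Pi.sub_apply] at hmono
  have h₁ := h.le_discrepancy (τ t) hne
  have h₂ : 0 ≤ C / 2 * Real.exp (-2 * t) := by positivity
  linarith

lemma IsAntipodalFlowSol.abs_discrepancy_le (hτ : IsAntipodalFlowSol ρ τ) (h : IsAntipodal ρ)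
    (h4 : HasFourPoints Z) {C : ℝ} (hC : ∀ ξ, |discrepancy ρ (τ 0) ξ| ≤ C)
    {t : ℝ} (ht : 0 ≤ t) (ξ : Z) :
    |discrepancy ρ (τ t) ξ| ≤ 2 * C * Real.exp (-t) := by
  have hC₀ : 0 ≤ C := (abs_nonneg _).trans (hC ξ)
  have hC' : ∀ ξ, discrepancy ρ (τ 0) ξ ≤ C := fun ξ => (le_abs_self _).trans (hC ξ)
  have hpos := Real.exp_pos (-t)
  rw [abs_le]
  constructor
  · set m := discrepancy ρ (τ t) ξ - τ t ξ with hm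
    have hneg : ∀ x ∈ Set.Ici (0 : ℝ), HasDerivWithinAt (fun x => Real.exp (-x))
        (-Real.exp (-x)) (Set.Ici 0) x := fun x _ => by
      simpa using ((hasDerivAt_id x).neg.exp).hasDerivWithinAt
    have hmono := le_of_hasDerivWithinAt_nonneg le_rfl ht
      (fun x hx => (((Real.hasDerivAt_exp x).hasDerivWithinAt (s := Set.Ici 0)).mul
        ((hτ.hasDerivWithinAt ξ x hx).add_const m)).sub ((hneg x hx).const_mul (C / 2)))
      (fun x hx => by
        have h₁ := hτ.discrepancy_sub_le h h4 hC' hC₀ hx.1 hx.2 ξ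
        have h₂ := mul_le_mul_of_nonneg_left h₁ (Real.exp_pos x).le
        have h₃ : Real.exp x * Real.exp (-2 * x) = Real.exp (-x) := by
          rw [← Real.exp_add]
          congr 1
          ring
        linear_combination h₂ + C / 2 * h₃)
    simp only [Pi.sub_apply, Pi.mul_apply, Real.exp_zero, neg_zero, one_mul, mul_one] at hmono
    have h₀ := hτ.discrepancy_sub_le h h4 hC' hC₀ le_rfl ht ξ
    simp only [mul_zero, Real.exp_zero, mul_one] at h₀
    have h₁ := (abs_le.1 (hC ξ)).1
    have h₂ : 0 ≤ C / 2 * Real.exp (-t) := by positivity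
    have h₃ : -(2 * C) ≤ Real.exp t * discrepancy ρ (τ t) ξ - C / 2 * Real.exp (-t) := by
      have : τ t ξ + m = discrepancy ρ (τ t) ξ := by rw [hm]; ring
      rw [this] at hmono
      linarith
    have h₄ : Real.exp t * Real.exp (-t) = 1 := by
      rw [← Real.exp_add]
      simp
    have h₅ := mul_le_mul_of_nonneg_right
      (show -(2 * C) ≤ Real.exp t * discrepancy ρ (τ t) ξ by linarith) hpos.le
    linear_combination h₅ + discrepancy ρ (τ t) ξ * h₄
  · have h₁ := hτ.discrepancy_le h h4 ht ξ
    have h₂ := mul_le_mul_of_nonneg_right (hC' ξ) (Real.exp_pos (-2 * t)).le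
    have h₃ : Real.exp (-2 * t) ≤ Real.exp (-t) := Real.exp_le_exp.2 (by linarith)
    have h₄ := mul_le_mul_of_nonneg_left h₃ hC₀
    have h₅ : 0 ≤ C * Real.exp (-t) := by positivity
    linarith

lemma IsAntipodalFlowSol.dist_le (hτ : IsAntipodalFlowSol ρ τ) (h : IsAntipodal ρ)
    (h4 : HasFourPoints Z) {C : ℝ} (hC : ∀ ξ, |discrepancy ρ (τ 0) ξ| ≤ C) (hC₀ : 0 ≤ C)
    {s t : ℝ} (hs : 0 ≤ s) (hst : s ≤ t) :
    dist (τ s) (τ t) ≤ 2 * C * Real.exp (-s) := by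
  rw [ContinuousMap.dist_le (by positivity)]
  intro ξ
  have hneg : ∀ x ∈ Set.Ici (0 : ℝ), HasDerivWithinAt (fun x => Real.exp (-x))
      (-Real.exp (-x)) (Set.Ici 0) x := fun x _ => by
    simpa using ((hasDerivAt_id x).neg.exp).hasDerivWithinAt
  have hD : ∀ x ∈ Set.Icc s t, |discrepancy ρ (τ x) ξ| ≤ 2 * C * Real.exp (-x) :=
    fun x hx => hτ.abs_discrepancy_le h h4 hC (hs.trans hx.1) ξ
  have h₁ := le_of_hasDerivWithinAt_nonneg hs hst
    (fun x hx => (hτ.hasDerivWithinAt ξ x hx).sub ((hneg x hx).const_mul (2 * C)))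
    (fun x hx => by linarith [(abs_le.1 (hD x hx)).2])
  have h₂ := le_of_hasDerivWithinAt_nonneg hs hst
    (fun x hx => ((hτ.hasDerivWithinAt ξ x hx).add ((hneg x hx).const_mul (2 * C))).neg)
    (fun x hx => by linarith [(abs_le.1 (hD x hx)).1])
  simp only [Pi.sub_apply, Pi.add_apply, Pi.neg_apply] at h₁ h₂
  have h₃ : 0 ≤ 2 * C * Real.exp (-t) := by positivity
  rw [Real.dist_eq, abs_le]
  constructor <;> linarith

end Flow

theorem statement7 [TopologicalSpace Z] [CompactSpace Z]
    [TopologicalSpace.MetrizableSpace Z] (h4 : HasFourPoints Z)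
    (ρ₀ : Z → Z → ℝ) (h₀ : IsAntipodal ρ₀)
    (ρ₁ : Z → Z → ℝ) (hρ₁ : ρ₁ ∈ MoebiusSpace ρ₀)
    (τ₀ : C(Z, ℝ)) (τ : ℝ → C(Z, ℝ)) (hτ0 : τ 0 = τ₀)
    (hτ : IsAntipodalFlowSol ρ₁ τ) :
    ∃ τinf : C(Z, ℝ),
      Tendsto τ atTop (𝓝 τinf) ∧
      (∀ t : ℝ, 0 ≤ t →
        ‖τ t - τinf‖ ≤ 4 * (⨆ η : Z, |discrepancy ρ₁ τ₀ η|) * Real.exp (-t / 2)) ∧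
      (∀ ξ : Z, discrepancy ρ₁ τinf ξ = 0) ∧
      eMap ρ₁ τinf ∈ MoebiusSpace ρ₀ ∧
      (∀ ξ : Z, Real.log (mDeriv ρ₁ (eMap ρ₁ τinf) ξ) = τinf ξ) := by
  subst hτ0
  obtain ⟨h, hequiv⟩ := hρ₁
  set C := ⨆ η : Z, |discrepancy ρ₁ (τ 0) η| with hCdef
  have hC : ∀ ξ, |discrepancy ρ₁ (τ 0) ξ| ≤ C := hτ.abs_discrepancy_le_iSup
  have hC₀ : 0 ≤ C := Real.iSup_nonneg fun _ => abs_nonneg _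
  have hlim : Tendsto (fun t : ℝ => 2 * C * Real.exp (-t)) atTop (𝓝 0) := by
    simpa using Real.tendsto_exp_neg_atTop_nhds_zero.const_mul (2 * C)
  have hcauchy : CauchySeq τ := by
    refine Metric.cauchySeq_iff'.2 fun ε hε => ?_
    obtain ⟨s, hs₀, hs⟩ := ((eventually_ge_atTop 0).and (hlim.eventually_lt_const hε)).exists
    refine ⟨s, fun t hst => ?_⟩
    rw [dist_comm]
    exact (hτ.dist_le h h4 hC hC₀ hs₀ hst).trans_lt hs
  obtain ⟨σ, hσ⟩ := cauchySeq_tendsto_of_complete hcauchy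
  have hdist : ∀ t, 0 ≤ t → ‖τ t - σ‖ ≤ 2 * C * Real.exp (-t) := by
    intro t ht
    rw [← dist_eq_norm]
    refine le_of_tendsto (tendsto_const_nhds.dist hσ) ?_
    filter_upwards [eventually_ge_atTop t] with u hu
    exact hτ.dist_le h h4 hC hC₀ ht hu
  have hzero : ∀ ξ, discrepancy ρ₁ σ ξ = 0 := by
    intro ξ
    have hlim' : Tendsto (fun t : ℝ => 3 * (2 * C * Real.exp (-t))) atTop (𝓝 0) := by
      simpa using hlim.const_mul 3
    refine abs_nonpos_iff.1 (ge_of_tendsto hlim' ?_)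
    filter_upwards [eventually_ge_atTop 0] with t ht
    have h₁ := abs_le.1 (hτ.abs_discrepancy_le h h4 hC ht ξ)
    have h₂ := h.discrepancy_le_add h4 (τ t) σ ξ
    have h₃ := h.discrepancy_le_add h4 σ (τ t) ξ
    rw [norm_sub_rev] at h₃
    have h₄ := hdist t ht
    rw [abs_le]
    constructor <;> linarith [h₁.1, h₁.2]
  refine ⟨σ, hσ, fun t ht => (hdist t ht).trans ?_, hzero, ⟨h.eMap h4 hzero, ?_⟩,
    log_mDeriv_eMap h.toIsSeparating h4 σ⟩
  · have h₁ : Real.exp (-t) ≤ Real.exp (-t / 2) := Real.exp_le_exp.2 (by linarith)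
    have h₂ := Real.exp_pos (-t / 2)
    exact mul_le_mul (by linarith) h₁ (Real.exp_pos _).le (by positivity)
  · intro ξ ξ' η η' h₁ h₂ h₃ h₄ h₅ h₆
    exact (hequiv ξ ξ' η η' h₁ h₂ h₃ h₄ h₅ h₆).trans
      (moebiusEquiv_eMap ρ₁ σ ξ ξ' η η' h₁ h₂ h₃ h₄ h₅ h₆)
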